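/- arXiv:1611.05998 — 2 statements merged into one kernel-verified Lean document; each statement's English description precedes it below -/
import Mathlib

section
/- Let d be even and let f be a homogeneous polynomial of degree d in n real variables with multilinear components {f_{2α}}. Then Λ(f) ≤ (1 + d/2) · max over multi-indices α with |α| ≤ d/2 of Λ(f_{2α}) / |𝒪(α)|. -/
open MvPolynomial

/-- `‖f‖₂ = sup_{‖x‖₂ = 1} |f(x)|` for a polynomial `f` in `n` real variables. -/
noncomputable def sphereNorm {n : ℕ} (f : MvPolynomial (Fin n) ℝ) : ℝ :=
  sSup {y | ∃ x : Fin n → ℝ, (∑ i, x i ^ 2) = 1 ∧ y = |eval x f|}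

/-- `M` is a (symmetric) matrix representation of the polynomial `h`, where rows and
columns are indexed by tuples `I ∈ [n]^k` (with `2k` the degree of `h`). -/
def IsMatrixRepr {n : ℕ} (k : ℕ) (M : Matrix (Fin k → Fin n) (Fin k → Fin n) ℝ)
    (h : MvPolynomial (Fin n) ℝ) : Prop :=
  M.IsSymm ∧ ∀ x : Fin n → ℝ,
    (∑ I : Fin k → Fin n, ∑ J : Fin k → Fin n,
      M I J * (∏ t, x (I t)) * (∏ t, x (J t))) = eval x h

/-- `sup_{‖z‖₂=1} zᵀ M z`, the maximum eigenvalue of the symmetric matrix `M`. -/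
noncomputable def maxEig {n k : ℕ} (M : Matrix (Fin k → Fin n) (Fin k → Fin n) ℝ) : ℝ :=
  sSup {y | ∃ z : (Fin k → Fin n) → ℝ, (∑ I, z I ^ 2) = 1 ∧
    y = ∑ I, ∑ J, z I * M I J * z J}

/-- `Λ(h)`: the infimum over matrix representations `M` of `h` of the maximum
eigenvalue of `M`; `k` is half the degree of `h`. -/
noncomputable def Lam {n : ℕ} (k : ℕ) (h : MvPolynomial (Fin n) ℝ) : ℝ :=
  sInf {y | ∃ M : Matrix (Fin k → Fin n) (Fin k → Fin n) ℝ, IsMatrixRepr k M h ∧ y = maxEig M}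


/-- A polynomial is multilinear if every variable appears with degree at most 1
in every monomial with nonzero coefficient. -/
def IsMultilinear {n : ℕ} (p : MvPolynomial (Fin n) ℝ) : Prop :=
  ∀ m ∈ p.support, ∀ i, m i ≤ 1

/-- `|α| = Σᵢ αᵢ`, the total degree of the multi-index `α`. -/
def mdeg {n : ℕ} (α : Fin n →₀ ℕ) : ℕ := α.sum fun _ e => e

/-- `g` is the multilinear decomposition of the degree-`d` homogeneous polynomial `f`,
i.e. `f = Σ_{|α| ≤ d/2} g α · x^{2α}` where each `g α` is multilinear and homogeneous
of degree `d - 2|α|`. -/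
def IsMLDecomp {n : ℕ} (d : ℕ) (f : MvPolynomial (Fin n) ℝ)
    (g : (Fin n →₀ ℕ) → MvPolynomial (Fin n) ℝ) : Prop :=
  (∀ α : Fin n →₀ ℕ,
      (mdeg α ≤ d / 2 → IsMultilinear (g α) ∧ (g α).IsHomogeneous (d - 2 * mdeg α)) ∧
      (d / 2 < mdeg α → g α = 0)) ∧
  f = ∑ᶠ α : Fin n →₀ ℕ, g α * monomial (2 • α) (1 : ℝ)

/-- `|𝒪(α)| = |α|! / ∏ᵢ αᵢ!`, the number of tuples corresponding to `α`. -/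
noncomputable def orbitCard {n : ℕ} (α : Fin n →₀ ℕ) : ℝ :=
  (Nat.factorial (mdeg α) : ℝ) / α.prod fun _ e => (Nat.factorial e : ℝ)


/-- The multi-index of a tuple. -/
noncomputable def tupIdx {n m : ℕ} (I : Fin m → Fin n) : Fin n →₀ ℕ :=
  ∑ t, Finsupp.single (I t) 1

/-- The quadratic form of a matrix. -/
noncomputable def qForm {ι : Type*} [Fintype ι] (M : Matrix ι ι ℝ) (z : ι → ℝ) : ℝ :=
  ∑ I, ∑ J, z I * M I J * z J

/-- `h` has a matrix representation with quadratic form bounded by `C`. -/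
def HasBd {n : ℕ} (k : ℕ) (h : MvPolynomial (Fin n) ℝ) (C : ℝ) : Prop :=
  ∃ M : Matrix (Fin k → Fin n) (Fin k → Fin n) ℝ, IsMatrixRepr k M h ∧
    ∀ z, qForm M z ≤ C * ∑ I, z I ^ 2

lemma mdeg_eq {n : ℕ} (α : Fin n →₀ ℕ) : mdeg α = ∑ i, α i := by
  unfold mdeg
  rw [Finsupp.sum_fintype]
  simp

lemma mdeg_tupIdx {n m : ℕ} (I : Fin m → Fin n) : mdeg (tupIdx I) = m := by
  rw [mdeg_eq]
  simp only [tupIdx, Finsupp.finsetSum_apply]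
  rw [Finset.sum_comm]
  simp [Finsupp.single_apply]

lemma prod_tup {n m : ℕ} (I : Fin m → Fin n) (x : Fin n → ℝ) :
    ∏ t, x (I t) = ∏ i, x i ^ (tupIdx I i) := by
  simp only [tupIdx, Finsupp.finsetSum_apply, ← Finset.prod_pow_eq_pow_sum]
  rw [Finset.prod_comm]
  refine Finset.prod_congr rfl fun t _ => ?_
  simp [Finsupp.single_apply, Finset.prod_ite_eq]

lemma orbitCard_eq {n : ℕ} (α : Fin n →₀ ℕ) :
    orbitCard α = (Nat.multinomial Finset.univ α : ℝ) := by
  unfold orbitCard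
  rw [mdeg_eq, ← Nat.multinomial_spec, Finsupp.prod_fintype _ _ (by simp)]
  have : (∏ i, (Nat.factorial (α i) : ℝ)) ≠ 0 :=
    Finset.prod_ne_zero_iff.2 fun i _ => by positivity
  push_cast
  field_simp

lemma orbitCard_pos {n : ℕ} (α : Fin n →₀ ℕ) : 0 < orbitCard α := by
  unfold orbitCard
  have : 0 < α.prod fun _ e => (Nat.factorial e : ℝ) :=
    Finset.prod_pos fun i _ => by positivity
  positivity

lemma card_orbit {n m : ℕ} (α : Fin n →₀ ℕ) (h : mdeg α = m) :
    ((Finset.univ.filter fun I : Fin m → Fin n => tupIdx I = α).card : ℝ) = orbitCard α := by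
  classical
  have h1 := Fintype.sum_pow (fun i : Fin n => (X i : MvPolynomial (Fin n) ℝ)) m
  rw [Finset.sum_pow_eq_sum_piAntidiag] at h1
  have h2 := congrArg (coeff α) h1
  have e1 : ∀ I : Fin m → Fin n, ∏ t, (X (I t) : MvPolynomial (Fin n) ℝ)
      = monomial (tupIdx I) 1 := by
    intro I
    simp only [X, tupIdx]
    rw [← monomial_sum_one]
  have e2 : ∀ k : Fin n → ℕ, ∏ i, (X i : MvPolynomial (Fin n) ℝ) ^ k i
      = monomial (Finsupp.equivFunOnFinite.symm k) 1 := by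
    intro k
    rw [monomial_eq, Finsupp.prod_fintype _ _ (by simp)]
    simp
  simp only [e1, e2, coeff_sum, coeff_monomial] at h2
  rw [orbitCard_eq, Finset.card_filter]
  push_cast
  rw [← h2, Finset.sum_eq_single (α : Fin n → ℕ)]
  · rw [← map_natCast (C : ℝ →+* MvPolynomial (Fin n) ℝ), coeff_C_mul, coeff_monomial]
    simp
  · intro b _ hb
    rw [← map_natCast (C : ℝ →+* MvPolynomial (Fin n) ℝ), coeff_C_mul, coeff_monomial, if_neg]
    · simp
    · rintro rfl
      exact hb (by simp)
  · intro hh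
    exact absurd (Finset.mem_piAntidiag.2 ⟨by rw [← h, mdeg_eq], by simp⟩) hh

lemma exists_tup {n m : ℕ} (α : Fin n →₀ ℕ) (h : mdeg α = m) :
    ∃ I : Fin m → Fin n, tupIdx I = α := by
  have h1 := card_orbit α h
  have h2 := orbitCard_pos α
  rw [← h1] at h2
  have h3 := Finset.card_pos.1 (by exact_mod_cast h2)
  obtain ⟨I, hI⟩ := h3
  exact ⟨I, (Finset.mem_filter.1 hI).2⟩

lemma isMatrixRepr_iff {n k : ℕ} (M : Matrix (Fin k → Fin n) (Fin k → Fin n) ℝ)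
    (h : MvPolynomial (Fin n) ℝ) :
    IsMatrixRepr k M h ↔ M.IsSymm ∧ ∀ x : Fin n → ℝ, qForm M (fun I => ∏ t, x (I t)) = eval x h := by
  unfold IsMatrixRepr qForm
  simp only [mul_comm (M _ _)]

lemma qForm_sum {ι κ : Type*} [Fintype ι] (s : Finset κ) (M : κ → Matrix ι ι ℝ) (z : ι → ℝ) :
    qForm (∑ i ∈ s, M i) z = ∑ i ∈ s, qForm (M i) z := by
  unfold qForm
  simp only [Matrix.sum_apply, Finset.mul_sum, Finset.sum_mul]
  rw [Finset.sum_comm]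
  conv_rhs => rw [Finset.sum_comm]
  rw [Finset.sum_comm]
  refine Finset.sum_congr rfl fun i _ => ?_
  rw [Finset.sum_comm]

lemma isSymm_sum {ι κ : Type*} (s : Finset κ) (M : κ → Matrix ι ι ℝ)
    (h : ∀ i ∈ s, (M i).IsSymm) : (∑ i ∈ s, M i).IsSymm := by
  unfold Matrix.IsSymm
  rw [Matrix.transpose_sum]
  exact Finset.sum_congr rfl h

lemma exists_repr {n k : ℕ} (h : MvPolynomial (Fin n) ℝ) (hh : h.IsHomogeneous (k + k)) :
    ∃ M : Matrix (Fin k → Fin n) (Fin k → Fin n) ℝ, IsMatrixRepr k M h := by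
  classical
  have key : ∀ β : Fin n →₀ ℕ, ∃ M : Matrix (Fin k → Fin n) (Fin k → Fin n) ℝ, M.IsSymm ∧
      (β ∈ h.support → ∀ x : Fin n → ℝ, qForm M (fun I => ∏ t, x (I t)) =
        coeff β h * ∏ i, x i ^ β i) := by
    intro β
    by_cases hβ : β ∈ h.support
    · have hdeg : mdeg β = k + k := by
        have := hh.degree_eq_sum_deg_support hβ
        unfold mdeg
        rw [this]; rfl
      obtain ⟨I, hI⟩ := exists_tup β hdeg
      set A : Fin k → Fin n := fun t => I (Fin.castAdd k t)
      set B : Fin k → Fin n := fun t => I (Fin.natAdd k t)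
      refine ⟨Matrix.single A B (coeff β h / 2) + Matrix.single B A (coeff β h / 2), ?_, ?_⟩
      · unfold Matrix.IsSymm
        rw [Matrix.transpose_add, Matrix.transpose_single, Matrix.transpose_single, add_comm]
      · intro _ x
        have hx : ∏ i, x i ^ β i = (∏ t, x (A t)) * ∏ t, x (B t) := by
          rw [← hI, ← prod_tup, Fin.prod_univ_add]
        have gen : ∀ (A B : Fin k → Fin n) (c : ℝ) (z : (Fin k → Fin n) → ℝ),
            ∑ I, ∑ J, z I * Matrix.single A B c I J * z J = z A * c * z B := by
          intro A B c z
          rw [Finset.sum_eq_single A, Finset.sum_eq_single B]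
          · simp
          · intro b _ hb; simp [hb.symm]
          · simp
          · intro b _ hb; simp [hb.symm]
          · simp
        unfold qForm
        simp only [Matrix.add_apply, mul_add, add_mul, Finset.sum_add_distrib]
        rw [gen, gen, hx]
        ring
    · exact ⟨0, by simp [Matrix.IsSymm], fun h => absurd h hβ⟩
  choose M hM1 hM2 using key
  refine ⟨∑ β ∈ h.support, M β, (isMatrixRepr_iff _ _).2 ⟨isSymm_sum _ _ fun i _ => hM1 i, ?_⟩⟩
  intro x
  rw [qForm_sum, eval_eq']
  exact Finset.sum_congr rfl fun β hβ => hM2 β hβ x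

lemma bdd_maxEig {n k : ℕ} (M : Matrix (Fin k → Fin n) (Fin k → Fin n) ℝ) :
    BddAbove {y | ∃ z : (Fin k → Fin n) → ℝ, (∑ I, z I ^ 2) = 1 ∧
    y = ∑ I, ∑ J, z I * M I J * z J} := by
  refine ⟨∑ I, ∑ J, |M I J|, ?_⟩
  rintro y ⟨z, hz, rfl⟩
  have hz1 : ∀ I, |z I| ≤ 1 := by
    intro I
    rw [← sq_le_one_iff_abs_le_one, ← hz]
    exact Finset.single_le_sum (f := fun I => z I ^ 2) (fun i _ => sq_nonneg _) (Finset.mem_univ I)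
  refine Finset.sum_le_sum fun I _ => Finset.sum_le_sum fun J _ => ?_
  refine (le_abs_self _).trans ?_
  rw [abs_mul, abs_mul]
  calc |z I| * |M I J| * |z J| ≤ 1 * |M I J| * 1 := by
        gcongr
        · exact hz1 I
        · exact hz1 J
    _ = _ := by ring

lemma qForm_le {n k : ℕ} (M : Matrix (Fin k → Fin n) (Fin k → Fin n) ℝ)
    (z : (Fin k → Fin n) → ℝ) : qForm M z ≤ maxEig M * ∑ I, z I ^ 2 := by
  have hs0 : 0 ≤ ∑ I, z I ^ 2 := Finset.sum_nonneg fun i _ => sq_nonneg _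
  rcases hs0.eq_or_lt with h0 | h0
  · have : z = 0 := by
      funext I
      have := (Finset.sum_eq_zero_iff_of_nonneg (fun i _ => sq_nonneg (z i))).1 h0.symm I
        (Finset.mem_univ I)
      simpa using this
    subst this
    simp [qForm]
  · set s := ∑ I, z I ^ 2
    have hle := le_csSup (bdd_maxEig M) ⟨fun I => z I / √s, by
      simp only [div_pow, Real.sq_sqrt hs0]
      rw [← Finset.sum_div]
      exact div_self h0.ne', rfl⟩
    have : ∑ I, ∑ J, z I / √s * M I J * (z J / √s) = qForm M z / s := by
      unfold qForm
      simp only [Finset.sum_div]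
      refine Finset.sum_congr rfl fun I _ => Finset.sum_congr rfl fun J _ => ?_
      have h1 : √s * √s = s := Real.mul_self_sqrt hs0
      rw [div_mul_eq_mul_div, div_mul_div_comm, h1]
    rw [this] at hle
    exact (div_le_iff₀ h0).1 hle

lemma hasBd_of_lt {n k : ℕ} (h : MvPolynomial (Fin n) ℝ) (hh : h.IsHomogeneous (k + k)) (c : ℝ)
    (hc : Lam k h < c) : HasBd k h c := by
  obtain ⟨M0, hM0⟩ := exists_repr h hh
  obtain ⟨y, ⟨M, hM, rfl⟩, hy⟩ := exists_lt_of_csInf_lt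
    (s := {y | ∃ M : Matrix (Fin k → Fin n) (Fin k → Fin n) ℝ, IsMatrixRepr k M h ∧ y = maxEig M})
    ⟨_, M0, hM0, rfl⟩ hc
  refine ⟨M, hM, fun z => (qForm_le M z).trans ?_⟩
  exact mul_le_mul_of_nonneg_right hy.le (Finset.sum_nonneg fun i _ => sq_nonneg _)

lemma lam_le {n k : ℕ} (hn : 0 < n) (h : MvPolynomial (Fin n) ℝ) (c : ℝ)
    (hc : HasBd k h c) : Lam k h ≤ c := by
  classical
  obtain ⟨M, hM, hb⟩ := hc
  set e : Fin n → ℝ := fun i => if i = ⟨0, hn⟩ then 1 else 0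
  have he : ∑ I : Fin k → Fin n, (∏ t, e (I t)) ^ 2 = 1 := by
    simp only [← Finset.prod_pow]
    rw [← Fintype.sum_pow (fun i => e i ^ 2)]
    simp [e]
  have hle : maxEig M ≤ c := by
    refine csSup_le ⟨_, _, he, rfl⟩ ?_
    rintro y ⟨z, hz, rfl⟩
    have := hb z
    rw [hz, mul_one] at this
    exact this
  refine le_trans (csInf_le ⟨eval e h, ?_⟩ ⟨M, hM, rfl⟩) hle
  rintro y ⟨M', hM', rfl⟩
  rw [← ((isMatrixRepr_iff _ _).1 hM').2 e]
  exact le_csSup (bdd_maxEig M') ⟨_, he, rfl⟩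

lemma HasBd.sum {n k : ℕ} {κ : Type*} (s : Finset κ) (h : κ → MvPolynomial (Fin n) ℝ) (c : κ → ℝ)
    (hc : ∀ i ∈ s, HasBd k (h i) (c i)) : HasBd k (∑ i ∈ s, h i) (∑ i ∈ s, c i) := by
  have : ∀ i, ∃ M : Matrix (Fin k → Fin n) (Fin k → Fin n) ℝ, i ∈ s → IsMatrixRepr k M (h i) ∧
    ∀ z, qForm M z ≤ c i * ∑ I, z I ^ 2 := by
    intro i
    by_cases hi : i ∈ s
    · obtain ⟨M, hM⟩ := hc i hi
      exact ⟨M, fun _ => hM⟩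
    · exact ⟨0, fun h => absurd h hi⟩
  choose M hM using this
  refine ⟨∑ i ∈ s, M i, (isMatrixRepr_iff _ _).2 ⟨isSymm_sum _ _ fun i hi => (hM i hi).1.1, ?_⟩, ?_⟩
  · intro x
    rw [qForm_sum, map_sum]
    exact Finset.sum_congr rfl fun i hi => ((isMatrixRepr_iff _ _).1 (hM i hi).1).2 x
  · intro z
    rw [qForm_sum, Finset.sum_mul]
    exact Finset.sum_le_sum fun i hi => (hM i hi).2 z

/-- Block diagonal matrix on tuples. -/
noncomputable def blk {n a m : ℕ}
    (M : (Fin m → Fin n) → Matrix (Fin a → Fin n) (Fin a → Fin n) ℝ) :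
    Matrix (Fin (a + m) → Fin n) (Fin (a + m) → Fin n) ℝ :=
  fun P Q => if ((Fin.appendEquiv a m).symm P).2 = ((Fin.appendEquiv a m).symm Q).2 then
    M ((Fin.appendEquiv a m).symm P).2 ((Fin.appendEquiv a m).symm P).1
      ((Fin.appendEquiv a m).symm Q).1 else 0

lemma sum_append {n a m : ℕ} (F : (Fin (a + m) → Fin n) → ℝ) :
    ∑ P, F P = ∑ U : Fin m → Fin n, ∑ I : Fin a → Fin n, F (Fin.append I U) := by
  rw [← (Fin.appendEquiv a m).sum_comp, Fintype.sum_prod_type, Finset.sum_comm]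
  rfl

lemma blk_append {n a m : ℕ}
    (M : (Fin m → Fin n) → Matrix (Fin a → Fin n) (Fin a → Fin n) ℝ) (I J U V) :
    blk M (Fin.append I U) (Fin.append J V) = if U = V then M U I J else 0 := by
  unfold blk
  have : ∀ (I : Fin a → Fin n) (U : Fin m → Fin n),
    (Fin.appendEquiv a m).symm (Fin.append I U) = (I, U) :=
    fun I U => (Fin.appendEquiv a m).symm_apply_apply (I, U)
  rw [this, this]

lemma qForm_blk {n a m : ℕ}
    (M : (Fin m → Fin n) → Matrix (Fin a → Fin n) (Fin a → Fin n) ℝ) (z) :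
    qForm (blk M) z = ∑ U, qForm (M U) (fun I => z (Fin.append I U)) := by
  unfold qForm
  rw [sum_append]
  refine Finset.sum_congr rfl fun U _ => Finset.sum_congr rfl fun I _ => ?_
  rw [sum_append]
  rw [Finset.sum_eq_single U]
  · simp [blk_append]
  · intro V _ hV
    simp [blk_append, hV.symm]
  · simp

lemma qForm_smul {ι : Type*} [Fintype ι] (c : ℝ) (M : Matrix ι ι ℝ) (z : ι → ℝ) :
    qForm (c • M) z = c * qForm M z := by
  unfold qForm
  simp only [Finset.mul_sum, Matrix.smul_apply, smul_eq_mul]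
  refine Finset.sum_congr rfl fun I _ => Finset.sum_congr rfl fun J _ => ?_
  ring

lemma qForm_smul_vec {ι : Type*} [Fintype ι] (c : ℝ) (M : Matrix ι ι ℝ) (z : ι → ℝ) :
    qForm M (fun I => z I * c) = c ^ 2 * qForm M z := by
  unfold qForm
  simp only [Finset.mul_sum]
  refine Finset.sum_congr rfl fun I _ => Finset.sum_congr rfl fun J _ => ?_
  ring

lemma hasBd_blk {n a m : ℕ} (g : (Fin n →₀ ℕ) → MvPolynomial (Fin n) ℝ) (c : ℝ)
    (hg : ∀ U : Fin m → Fin n, HasBd a (g (tupIdx U)) (orbitCard (tupIdx U) * c)) :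
    HasBd (a + m) (∑ α ∈ Finset.univ.image (tupIdx : (Fin m → Fin n) → _),
      g α * monomial (2 • α) (1 : ℝ)) c := by
  classical
  choose M hM using hg
  refine ⟨blk fun U => (orbitCard (tupIdx U))⁻¹ • M U, (isMatrixRepr_iff _ _).2 ⟨?_, ?_⟩, ?_⟩
  · ext P Q
    obtain ⟨⟨I, U⟩, rfl⟩ := (Fin.appendEquiv a m).surjective P
    obtain ⟨⟨J, V⟩, rfl⟩ := (Fin.appendEquiv a m).surjective Q
    have eA : ∀ (I : Fin a → Fin n) (U : Fin m → Fin n),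
      Fin.appendEquiv a m (I, U) = Fin.append I U := fun _ _ => rfl
    rw [Matrix.transpose_apply, eA, eA, blk_append, blk_append]
    by_cases hUV : U = V
    · subst hUV
      rw [if_pos rfl, if_pos rfl, Matrix.smul_apply, Matrix.smul_apply, (hM U).1.1.apply]
    · rw [if_neg hUV, if_neg (Ne.symm hUV)]
  · intro x
    rw [qForm_blk, map_sum]
    have h1 : ∀ U : Fin m → Fin n, qForm ((orbitCard (tupIdx U))⁻¹ • M U)
        (fun I => ∏ t, x (Fin.append I U t)) =
        (fun α => (orbitCard α)⁻¹ * eval x (g α * monomial (2 • α) (1 : ℝ))) (tupIdx U) := by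
      intro U
      have : (fun I : Fin a → Fin n => ∏ t, x (Fin.append I U t)) =
          fun I => (∏ t, x (I t)) * ∏ t, x (U t) := by
        funext I
        rw [Fin.prod_univ_add]
        simp
      rw [this, qForm_smul, qForm_smul_vec, ((isMatrixRepr_iff _ _).1 (hM U).1).2 x, prod_tup]
      simp only [map_mul, eval_monomial, one_mul]
      rw [Finsupp.prod_fintype _ _ (by simp), ← Finset.prod_pow]
      simp only [Finsupp.smul_apply, smul_eq_mul, ← pow_mul, mul_comm 2]
      ring
    rw [Finset.sum_congr rfl fun U _ => h1 U]
    rw [← Finset.sum_fiberwise_of_maps_to (t := Finset.univ.image tupIdx) (g := tupIdx)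
      (fun i hi => Finset.mem_image_of_mem _ hi)]
    refine Finset.sum_congr rfl fun α hα => ?_
    obtain ⟨U0, _, hU0⟩ := Finset.mem_image.1 hα
    have hdeg : mdeg α = m := by rw [← hU0, mdeg_tupIdx]
    rw [Finset.sum_congr rfl (g := fun _ => (orbitCard α)⁻¹ *
      eval x (g α * monomial (2 • α) (1 : ℝ)))]
    · rw [Finset.sum_const, nsmul_eq_mul, card_orbit α hdeg, ← mul_assoc,
        mul_inv_cancel₀ (orbitCard_pos α).ne', one_mul]
    · intro U hU
      rw [(Finset.mem_filter.1 hU).2]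
  · intro z
    rw [qForm_blk, sum_append, Finset.mul_sum]
    refine Finset.sum_le_sum fun U _ => ?_
    rw [qForm_smul]
    have hp := orbitCard_pos (tupIdx U)
    rw [inv_mul_le_iff₀ hp, ← mul_assoc]
    exact (hM U).2 _

theorem stmt6 (n d : ℕ) (hd : Even d) (f : MvPolynomial (Fin n) ℝ)
    (hf : f.IsHomogeneous d) (g : (Fin n →₀ ℕ) → MvPolynomial (Fin n) ℝ)
    (hg : IsMLDecomp d f g) :
    ∃ α : Fin n →₀ ℕ, mdeg α ≤ d / 2 ∧
      Lam (d / 2) f ≤ (1 + (d : ℝ) / 2) * (Lam (d / 2 - mdeg α) (g α) / orbitCard α) := by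
  classical
  obtain ⟨k, rfl⟩ := hd
  have hk : (k + k) / 2 = k := by omega
  have hk' : ((k + k : ℕ) : ℝ) / 2 = k := by push_cast; ring
  rw [hk']
  simp only [IsMLDecomp, hk] at hg ⊢
  obtain ⟨hg1, hg2⟩ := hg
  have h0 : mdeg (0 : Fin n →₀ ℕ) = 0 := by simp [mdeg]
  rcases Nat.eq_zero_or_pos n with rfl | hn
  · refine ⟨0, by omega, ?_⟩
    have hfg : f = g 0 := by
      rw [hg2, finsum_eq_single _ 0]
      · simp
      · intro α hα
        exact absurd (Subsingleton.elim α 0) hα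
    have ho : orbitCard (0 : Fin 0 →₀ ℕ) = 1 := by simp [orbitCard, mdeg]
    rw [← hfg, h0, ho, div_one, Nat.sub_zero]
    rcases Nat.eq_zero_or_pos k with rfl | hkp
    · simp
    · have : Lam k f = 0 := by
        have : Nonempty (Fin k) := ⟨⟨0, hkp⟩⟩
        have hm : ∀ M : Matrix (Fin k → Fin 0) (Fin k → Fin 0) ℝ, maxEig M = 0 := by
          intro M
          simp [maxEig]
        obtain ⟨M, hM⟩ := exists_repr f hf
        have : {y | ∃ M : Matrix (Fin k → Fin 0) (Fin k → Fin 0) ℝ,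
            IsMatrixRepr k M f ∧ y = maxEig M} = {0} := by
          ext y
          simp only [hm, Set.mem_ofPred_eq, Set.mem_singleton_iff]
          exact ⟨fun ⟨_, _, h⟩ => h, fun h => ⟨M, hM, h⟩⟩
        rw [Lam, this, csInf_singleton]
      simp [this]
  · set S : Finset (Fin n →₀ ℕ) := (Finset.range (k + 1)).biUnion fun m =>
      Finset.univ.image (tupIdx : (Fin m → Fin n) → _) with hS
    have memS : ∀ α, α ∈ S ↔ mdeg α ≤ k := by
      intro α
      simp only [hS, Finset.mem_biUnion, Finset.mem_range, Finset.mem_image, Finset.mem_univ,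
        true_and]
      constructor
      · rintro ⟨m, hm, I, rfl⟩
        rw [mdeg_tupIdx]; omega
      · intro h
        exact ⟨mdeg α, by omega, exists_tup α rfl⟩
    obtain ⟨α, hα, hmax⟩ := S.exists_max_image (fun α => Lam (k - mdeg α) (g α) / orbitCard α)
      ⟨0, (memS 0).2 (by omega)⟩
    refine ⟨α, (memS α).1 hα, ?_⟩
    set B := Lam (k - mdeg α) (g α) / orbitCard α
    have hfS : f = ∑ m ∈ Finset.range (k + 1),
        ∑ α ∈ Finset.univ.image (tupIdx : (Fin m → Fin n) → _),
          g α * monomial (2 • α) (1 : ℝ) := by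
      rw [hg2, finsum_eq_sum_of_support_subset (s := S), hS, Finset.sum_biUnion]
      · intro m _ m' _ hmm
        refine Finset.disjoint_left.2 fun β h1 h2 => hmm ?_
        obtain ⟨I, _, rfl⟩ := Finset.mem_image.1 h1
        obtain ⟨J, _, hJ⟩ := Finset.mem_image.1 h2
        rw [← mdeg_tupIdx I, ← hJ, mdeg_tupIdx]
      · intro β hβ
        rw [Finset.mem_coe, memS]
        by_contra hc
        exact hβ (by simp [(hg1 β).2 (by omega)])
    have main : ∀ ε > 0, Lam k f ≤ (1 + (k : ℝ)) * (B + ε) := by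
      intro ε hε
      refine lam_le hn f _ ?_
      have e : (1 + (k : ℝ)) * (B + ε) = ∑ m ∈ Finset.range (k + 1), (B + ε) := by
        simp only [Finset.sum_const, Finset.card_range, nsmul_eq_mul]
        push_cast
        ring
      rw [hfS, e]
      refine HasBd.sum _ _ _ fun m hm => ?_
      have hmk : m ≤ k := by have := Finset.mem_range.1 hm; omega
      obtain ⟨a, ha⟩ : ∃ a, k = a + m := ⟨k - m, by omega⟩
      have hb : ∀ U : Fin m → Fin n,
          HasBd a (g (tupIdx U)) (orbitCard (tupIdx U) * (B + ε)) := by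
        intro U
        have hU := mdeg_tupIdx U
        have hUk : mdeg (tupIdx U) ≤ k := by omega
        refine hasBd_of_lt _ ?_ _ ?_
        · have := ((hg1 _).1 hUk).2
          rw [hU] at this
          convert this using 1
          omega
        · have := hmax _ ((memS _).2 hUk)
          simp only [hU] at this
          rw [show k - m = a by omega] at this
          have hp := orbitCard_pos (tupIdx U)
          rw [mul_comm, ← div_lt_iff₀ hp]
          linarith
      have := hasBd_blk g (B + ε) hb
      rw [← ha] at this
      exact this
    refine le_of_forall_pos_le_add fun ε hε => ?_
    have hk1 : (0 : ℝ) < 1 + k := by positivity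
    have := main (ε / (1 + k)) (by positivity)
    rw [mul_add, mul_div_cancel₀ _ hk1.ne'] at this
    exact this
end

section
/- There is an absolute constant C > 0 such that the following holds. Let f be a homogeneous polynomial of degree d in n real variables with multilinear components {f_{2α}}. Then for every multi-index α with |α| ≤ d/2, ‖f‖₂ ≥ ‖f_{2α}‖₂ / ( C^d · |𝒪(α)| ). -/
open MvPolynomial

lemma aeval_smul_hom {n d : ℕ} {f : MvPolynomial (Fin n) ℝ} (hf : f.IsHomogeneous d)
    {A : Type*} [CommRing A] [Algebra ℝ A] (c : A) (x : Fin n → A) :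
    aeval (fun i => c * x i) f = c ^ d * aeval x f := by
  rw [aeval_def, aeval_def, eval₂_eq', eval₂_eq', Finset.mul_sum]
  refine Finset.sum_congr rfl fun m hm => ?_
  have h : ∑ i, m i = d := by
    have := hf (mem_support_iff.mp hm)
    rw [← this, Finsupp.weight_apply, Finsupp.sum_fintype] <;> simp
  simp only [mul_pow, Finset.prod_mul_distrib, Finset.prod_pow_eq_pow_sum, h]
  ring

lemma real_bound {n d : ℕ} {f : MvPolynomial (Fin n) ℝ} (hf : f.IsHomogeneous d) (M : ℝ)
    (hM : ∀ x : Fin n → ℝ, (∑ i, x i ^ 2) = 1 → |eval x f| ≤ M)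
    (y : Fin n → ℝ) (hy : (∑ i, y i ^ 2) = 1) (x : Fin n → ℝ) (R : ℝ) (hR : 0 ≤ R)
    (hx : ∑ i, x i ^ 2 ≤ R ^ 2) : |eval x f| ≤ M * R ^ d := by
  have hM0 : 0 ≤ M := (abs_nonneg _).trans (hM y hy)
  set s := Real.sqrt (∑ i, x i ^ 2) with hs
  have hs2 : s ^ 2 = ∑ i, x i ^ 2 := Real.sq_sqrt (Finset.sum_nonneg fun i _ => sq_nonneg _)
  have hs0 : 0 ≤ s := Real.sqrt_nonneg _
  have hsR : s ≤ R := by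
    rw [← hs2] at hx
    exact (sq_le_sq₀ hs0 hR).mp hx
  obtain ⟨v, hv, hxv⟩ : ∃ v : Fin n → ℝ, (∑ i, v i ^ 2) = 1 ∧ x = fun i => s * v i := by
    by_cases h : s = 0
    · refine ⟨y, hy, ?_⟩
      rw [h] at hs2
      have : ∀ i ∈ Finset.univ, x i ^ 2 = 0 :=
        (Finset.sum_eq_zero_iff_of_nonneg (fun i _ => sq_nonneg _)).mp (by rw [← hs2]; simp)
      funext i
      have := this i (Finset.mem_univ i)
      rw [h, zero_mul]
      exact pow_eq_zero_iff two_ne_zero |>.mp this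
    · refine ⟨fun i => x i / s, ?_, ?_⟩
      · simp only [div_pow]
        rw [← Finset.sum_div, ← hs2, div_self (pow_ne_zero _ h)]
      · funext i
        field_simp
  have e := aeval_smul_hom hf s v
  rw [← hxv] at e
  change eval x f = s ^ d * eval v f at e
  rw [e, abs_mul, abs_of_nonneg (pow_nonneg hs0 d), mul_comm]
  exact mul_le_mul (hM v hv) (pow_le_pow_left₀ hs0 hsR d) (pow_nonneg hs0 d) hM0

lemma aeval_ofReal {n : ℕ} (f : MvPolynomial (Fin n) ℝ) (x : Fin n → ℝ) :
    aeval (fun i => ((x i : ℝ) : ℂ)) f = ((eval x f : ℝ) : ℂ) := by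
  rw [aeval_def, eval₂_eq', eval_eq']
  simp

lemma complex_bound {n d : ℕ} {f : MvPolynomial (Fin n) ℝ} (hf : f.IsHomogeneous d) (M : ℝ)
    (hM : ∀ x : Fin n → ℝ, (∑ i, x i ^ 2) = 1 → |eval x f| ≤ M)
    (y : Fin n → ℝ) (hy : (∑ i, y i ^ 2) = 1) (z : Fin n → ℂ) (R : ℝ) (hR : 0 ≤ R)
    (hz : ∑ i, ‖z i‖ ^ 2 ≤ R ^ 2) : ‖aeval z f‖ ≤ M * (2 * R) ^ d := by
  let F : ℂ → ℂ := fun w => aeval (fun i => z i + w * (starRingEnd ℂ) (z i)) f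
  have hF : Differentiable ℂ F := by
    have : F = fun w => ∑ m ∈ f.support, algebraMap ℝ ℂ (f.coeff m) *
        ∏ i, (z i + w * (starRingEnd ℂ) (z i)) ^ m i := by
      funext w
      simp only [F]
      rw [aeval_def, eval₂_eq']
    rw [this]
    fun_prop
  have key : ∀ w ∈ frontier (Metric.ball (0 : ℂ) 1), ‖F w‖ ≤ M * (2 * R) ^ d := by
    intro w hw
    rw [frontier_ball (0 : ℂ) one_ne_zero, mem_sphere_zero_iff_norm] at hw
    obtain ⟨u, hu⟩ := IsAlgClosed.exists_pow_nat_eq w (n := 2) (by norm_num)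
    have hu1 : ‖u‖ = 1 := by
      have : ‖u‖ ^ 2 = 1 := by rw [← norm_pow, hu, hw]
      exact (pow_eq_one_iff_of_nonneg (norm_nonneg _) two_ne_zero).mp this
    have huu : u * (starRingEnd ℂ) u = 1 := by
      rw [Complex.mul_conj, Complex.normSq_eq_norm_sq, hu1]; simp
    have e : (fun i => z i + w * (starRingEnd ℂ) (z i)) =
        fun i => u * (((2 * ((starRingEnd ℂ) u * z i).re : ℝ)) : ℂ) := by
      funext i
      have h2 := Complex.add_conj ((starRingEnd ℂ) u * z i)
      rw [← h2, ← hu]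
      simp only [map_mul, Complex.conj_conj]
      linear_combination (-(z i)) * huu
    simp only [F]
    rw [e, aeval_smul_hom hf, norm_mul, norm_pow, hu1, one_pow, one_mul,
      aeval_ofReal f (fun i => 2 * ((starRingEnd ℂ) u * z i).re), Complex.norm_real, Real.norm_eq_abs]
    refine real_bound hf M hM y hy _ _ (by positivity) ?_
    calc ∑ i, (2 * ((starRingEnd ℂ) u * z i).re) ^ 2 ≤ ∑ i, 4 * ‖z i‖ ^ 2 := by
          refine Finset.sum_le_sum fun i _ => ?_
          have h1 := Complex.abs_re_le_norm ((starRingEnd ℂ) u * z i)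
          rw [norm_mul, RCLike.norm_conj, hu1, one_mul] at h1
          have := sq_le_sq' (by linarith [neg_abs_le ((starRingEnd ℂ) u * z i).re]) ((le_abs_self _).trans h1)
          nlinarith
      _ ≤ (2 * R) ^ 2 := by rw [← Finset.mul_sum]; nlinarith
  have := Complex.norm_le_of_forall_mem_frontier_norm_le Metric.isBounded_ball
    hF.diffContOnCl key (z := 0) (subset_closure (by simp))
  simpa [F] using this

lemma extract {n d : ℕ} {κ : Type*} [Fintype κ] (w z : Fin n → κ → ℂ) (y : Fin n → ℝ)
    (α : Fin n →₀ ℕ)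
    (H : ∀ i b, b ≤ d → ∑ j, w i j * z i j ^ b =
      if b = 2 * α i then 1 else if b = 2 * α i + 1 then (y i : ℂ) else 0)
    (f : MvPolynomial (Fin n) ℝ) (g : (Fin n →₀ ℕ) → MvPolynomial (Fin n) ℝ)
    (hg : IsMLDecomp d f g) (_hα : mdeg α ≤ d / 2) :
    ∑ j : Fin n → κ, (∏ i, w i (j i)) * aeval (fun i => z i (j i)) f = ((eval y (g α) : ℝ) : ℂ) := by
  classical
  let Lf : MvPolynomial (Fin n) ℝ →+ ℂ :=
    { toFun := fun p => ∑ j : Fin n → κ, (∏ i, w i (j i)) * aeval (fun i => z i (j i)) p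
      map_zero' := by simp
      map_add' := fun p q => by simp [mul_add, Finset.sum_add_distrib] }
  have mdeg_eq : ∀ γ : Fin n →₀ ℕ, mdeg γ = ∑ i, γ i := fun γ => by
    unfold mdeg; rw [Finsupp.sum_fintype]; simp
  have hLm : ∀ (b : Fin n →₀ ℕ) (a : ℝ), Lf (monomial b a) = a * ∏ i, ∑ j, w i j * z i j ^ b i := by
    intro b a
    change ∑ j : Fin n → κ, (∏ i, w i (j i)) * aeval (fun i => z i (j i)) (monomial b a) = _
    rw [Fintype.prod_sum, Finset.mul_sum]
    refine Finset.sum_congr rfl fun j _ => ?_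
    rw [aeval_monomial, Finsupp.prod_fintype _ _ (by simp), Finset.prod_mul_distrib]
    simp; ring
  have hLg : ∀ γ, Lf (g γ * monomial (2 • γ) (1 : ℝ)) =
      if γ = α then ((eval y (g α) : ℝ) : ℂ) else 0 := by
    intro γ
    by_cases hγ : d / 2 < mdeg γ
    · rw [(hg.1 γ).2 hγ, if_neg]
      · simp
      · rintro rfl; omega
    push Not at hγ
    obtain ⟨hml, hhom⟩ := (hg.1 γ).1 hγ
    have hterm : ∀ m ∈ (g γ).support, Lf (monomial m ((g γ).coeff m) * monomial (2 • γ) (1 : ℝ)) =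
        if γ = α then (((g γ).coeff m : ℝ) : ℂ) * ∏ i, (y i : ℂ) ^ m i else 0 := by
      intro m hm
      rw [monomial_mul, mul_one, hLm]
      have hmd : ∑ i, m i = d - 2 * mdeg γ := by
        have := hhom (mem_support_iff.mp hm)
        rw [← this, Finsupp.weight_apply, Finsupp.sum_fintype] <;> simp
      have hle : ∀ i, (m + 2 • γ) i ≤ d := by
        intro i
        have h1 := Finset.single_le_sum (f := m) (fun i _ => Nat.zero_le _) (Finset.mem_univ i)
        have h2 := Finset.single_le_sum (f := γ) (fun i _ => Nat.zero_le _) (Finset.mem_univ i)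
        rw [← mdeg_eq] at h2
        simp only [Finsupp.add_apply, Finsupp.smul_apply, smul_eq_mul]
        omega
      simp only [fun i => H i _ (hle i)]
      have hbi : ∀ i, (m + 2 • γ) i = m i + 2 * γ i := fun i => by simp
      split_ifs with h
      · subst h
        congr 1
        refine Finset.prod_congr rfl fun i _ => ?_
        have := hml m hm i
        have hb := hbi i
        rcases Nat.le_one_iff_eq_zero_or_eq_one.mp this with h0 | h0
        · rw [if_pos (by omega), h0, pow_zero]
        · rw [if_neg (by omega), if_pos (by omega), h0, pow_one]
      · obtain ⟨i, hi⟩ : ∃ i, γ i ≠ α i := by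
          by_contra hc; push Not at hc; exact h (Finsupp.ext hc)
        rw [Finset.prod_eq_zero (Finset.mem_univ i), mul_zero]
        have := hml m hm i
        have hb := hbi i
        rw [if_neg (by omega), if_neg (by omega)]
    conv_lhs => rw [(g γ).as_sum, Finset.sum_mul, map_sum]
    rw [Finset.sum_congr rfl hterm]
    split_ifs with h
    · subst h
      rw [eval_eq']
      simp
    · simp
  have hfin : (Function.support fun γ => g γ * monomial (2 • γ) (1 : ℝ)).Finite := by
    refine (Set.finite_Iic (Finsupp.equivFunOnFinite.symm fun _ : Fin n => d / 2)).subset ?_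
    intro γ hγ
    by_contra hc
    apply hγ
    have : d / 2 < mdeg γ := by
      by_contra hlt
      apply hc
      intro i
      have h2 := Finset.single_le_sum (f := γ) (fun i _ => Nat.zero_le _) (Finset.mem_univ i)
      rw [← mdeg_eq] at h2
      simp
      omega
    simp [(hg.1 γ).2 this]
  change Lf f = _
  rw [hg.2, AddMonoidHom.map_finsum _ hfin]
  simp only [hLg]
  rw [finsum_eq_single _ α (by intro x hx; simp [hx])]
  simp

lemma root_sum {N : ℕ} {ζ : ℂ} (hζ : IsPrimitiveRoot ζ N) (m : ℤ) (hm : |m| < N) :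
    ∑ j : Fin N, (ζ ^ (j : ℕ)) ^ m = if m = 0 then (N : ℂ) else 0 := by
  split_ifs with h
  · simp [h]
  have h1 : ζ ^ m ≠ 1 := by
    intro h1
    rw [hζ.zpow_eq_one_iff_dvd] at h1
    exact h (Int.eq_zero_of_abs_lt_dvd h1 hm)
  have h2 : ∀ j : Fin N, (ζ ^ (j : ℕ)) ^ m = (ζ ^ m) ^ (j : ℕ) := by
    intro j
    rw [← zpow_natCast, ← zpow_natCast, ← zpow_mul, ← zpow_mul, mul_comm]
  simp only [h2]
  rw [Fin.sum_univ_eq_sum_range (fun j => (ζ ^ m) ^ j) N, geom_sum_eq h1]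
  have : (ζ ^ m) ^ N = 1 := by
    rw [← zpow_natCast, ← zpow_mul, mul_comm, zpow_mul, zpow_natCast, hζ.pow_eq_one, one_zpow]
  simp [this]

lemma coord (d a : ℕ) (ha : 2 * a ≤ d) (y r : ℝ) (hr : 0 ≤ r) (hy : 2 * |y| ≤ r)
    (hr0 : r = 0 → a = 0) :
    ∃ w z : Fin (d + 2) → ℂ,
      (∀ b, b ≤ d → ∑ j, w j * z j ^ b =
        if b = 2 * a then 1 else if b = 2 * a + 1 then (y : ℂ) else 0) ∧
      (∀ j, ‖z j‖ ≤ r) ∧ ∑ j, ‖w j‖ ≤ 2 ^ a * (r ^ (2 * a))⁻¹ := by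
  set N := d + 2 with hN
  have hNC : (N : ℂ) ≠ 0 := by rw [hN]; exact_mod_cast (by omega : d + 2 ≠ 0)
  have hNR : (0 : ℝ) < N := by rw [hN]; positivity
  obtain ⟨ζ, hζ⟩ : ∃ ζ : ℂ, IsPrimitiveRoot ζ N := ⟨_, Complex.isPrimitiveRoot_exp N (by omega)⟩
  have hζn : ‖ζ‖ = 1 := hζ.norm'_eq_one (by omega)
  have hζ0 : ζ ≠ 0 := by intro h; simp [h] at hζn
  set ω : Fin N → ℂ := fun j => ζ ^ (j : ℕ) with hω
  have hω0 : ∀ j, ω j ≠ 0 := fun j => pow_ne_zero _ hζ0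
  have hωn : ∀ j, ‖ω j‖ = 1 := fun j => by simp [hω, hζn]
  have hsum : ∀ m : ℤ, |m| < N → ∑ j, ω j ^ m = if m = 0 then (N : ℂ) else 0 :=
    root_sum hζ
  set c : ℝ := y / r with hc
  have hcr : c * r = y := by
    by_cases h : r = 0
    · have : y = 0 := by rw [h] at hy; exact abs_eq_zero.mp (by linarith [abs_nonneg y])
      rw [h, this]; simp
    · rw [hc]; field_simp
  have hc2 : |c| ≤ 1 / 2 := by
    rw [hc, abs_div, abs_of_nonneg hr]
    by_cases h : r = 0
    · rw [h]; norm_num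
    · rw [div_le_iff₀ (lt_of_le_of_ne hr (Ne.symm h))]; linarith
  set ε : ℝ := if a = 0 then 1 else 0 with hε
  have hra : r ^ (2 * a) ≠ 0 := by
    by_cases h : a = 0
    · simp [h]
    · exact pow_ne_zero _ (fun h' => h (hr0 h'))
  have hraC : (r : ℂ) ^ (2 * a) ≠ 0 := by exact_mod_cast hra
  refine ⟨fun j => (N : ℂ)⁻¹ * ((r : ℂ) ^ (2 * a))⁻¹ * (ω j ^ (-(2 * a : ℤ)) *
      (1 + c * ω j ^ (-1 : ℤ) + ε * c * ω j ^ (1 : ℤ))), fun j => r * ω j, ?_, ?_, ?_⟩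
  · intro b hb
    have e : ∀ j, (N : ℂ)⁻¹ * ((r : ℂ) ^ (2 * a))⁻¹ * (ω j ^ (-(2 * a : ℤ)) *
      (1 + c * ω j ^ (-1 : ℤ) + ε * c * ω j ^ (1 : ℤ))) * (r * ω j) ^ b =
      (N : ℂ)⁻¹ * ((r : ℂ) ^ (2 * a))⁻¹ * (r : ℂ) ^ b * (ω j ^ ((b : ℤ) - 2 * a) +
        c * ω j ^ ((b : ℤ) - 2 * a - 1) + ε * c * ω j ^ ((b : ℤ) - 2 * a + 1)) := by
      intro j
      have h1 : ω j ^ ((b : ℤ) - 2 * a) = ω j ^ (-(2 * a : ℤ)) * ω j ^ b := by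
        rw [← zpow_natCast, ← zpow_add₀ (hω0 j)]; congr 1; ring
      rw [zpow_sub₀ (hω0 j) _ 1, zpow_add₀ (hω0 j) _ 1, h1, mul_pow, zpow_neg _ 1, zpow_one]
      ring
    rw [Finset.sum_congr rfl fun j _ => e j, ← Finset.mul_sum, Finset.sum_add_distrib,
      Finset.sum_add_distrib, ← Finset.mul_sum, ← Finset.mul_sum]
    rw [hsum _ (by rw [abs_lt]; omega), hsum _ (by rw [abs_lt]; omega),
      hsum _ (by rw [abs_lt]; omega)]
    have h3 : (ε : ℂ) * c * (if (b : ℤ) - 2 * a + 1 = 0 then (N : ℂ) else 0) = 0 := by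
      by_cases h : a = 0
      · rw [if_neg (by omega), mul_zero]
      · simp [hε, h]
    rw [h3]
    have hcrC : (c : ℂ) * r = y := by exact_mod_cast hcr
    by_cases h : b = 2 * a
    · subst h
      rw [if_pos (by push_cast; ring), if_neg (by push_cast; omega), if_pos rfl]
      field_simp
      simp
    · rw [if_neg h, if_neg (by omega)]
      by_cases h' : b = 2 * a + 1
      · subst h'
        rw [if_pos (by push_cast; ring), if_pos rfl, ← hcrC, pow_succ]
        field_simp
        simp only [zero_add, add_zero]
        ring
      · rw [if_neg h', if_neg (by omega)]
        simp
  · intro j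
    simp only [norm_mul, hωn, mul_one, Complex.norm_real, Real.norm_eq_abs, abs_of_nonneg hr]
    exact le_rfl
  · have e : ∀ j, ‖(N : ℂ)⁻¹ * ((r : ℂ) ^ (2 * a))⁻¹ * (ω j ^ (-(2 * a : ℤ)) *
      (1 + c * ω j ^ (-1 : ℤ) + ε * c * ω j ^ (1 : ℤ)))‖ = (N : ℝ)⁻¹ * (r ^ (2 * a))⁻¹ *
        ‖1 + c * ω j ^ (-1 : ℤ) + ε * c * ω j ^ (1 : ℤ)‖ := by
      intro j
      rw [norm_mul, norm_mul, norm_mul, norm_zpow, hωn, one_zpow, one_mul, norm_inv, norm_inv,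
        norm_pow, Complex.norm_natCast, Complex.norm_real, Real.norm_eq_abs, abs_of_nonneg hr]
    rw [Finset.sum_congr rfl fun j _ => e j, ← Finset.mul_sum]
    have key : ∑ j, ‖1 + c * ω j ^ (-1 : ℤ) + ε * c * ω j ^ (1 : ℤ)‖ ≤ N * 2 ^ a := by
      by_cases h : a = 0
      · have e2 : ∀ j, 1 + c * ω j ^ (-1 : ℤ) + ε * c * ω j ^ (1 : ℤ) =
            ((1 + 2 * c * (ω j).re : ℝ) : ℂ) := by
          intro j
          have h1 : ω j ^ (-1 : ℤ) = (starRingEnd ℂ) (ω j) := by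
            rw [zpow_neg_one, Complex.inv_def, Complex.normSq_eq_norm_sq, hωn]; simp
          have h2 := Complex.add_conj (ω j)
          rw [h1, zpow_one]
          push_cast at h2 ⊢
          simp only [hε, if_pos h]
          push_cast
          linear_combination (c : ℂ) * h2
        have e3 : ∀ j, ‖((1 + 2 * c * (ω j).re : ℝ) : ℂ)‖ = 1 + 2 * c * (ω j).re := by
          intro j
          rw [Complex.norm_real, Real.norm_eq_abs, abs_of_nonneg]
          have h1 := Complex.abs_re_le_norm (ω j)
          rw [hωn] at h1
          have h2 : |c * (ω j).re| ≤ 1 / 2 * 1 := by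
            rw [abs_mul]; exact mul_le_mul hc2 h1 (abs_nonneg _) (by norm_num)
          have := neg_abs_le (c * (ω j).re)
          linarith
        have h0 : ∑ j, (ω j).re = 0 := by
          have := hsum 1 (by rw [abs_one]; omega)
          simp only [zpow_one, one_ne_zero, if_false] at this
          rw [← Complex.re_sum, this, Complex.zero_re]
        simp only [e2, e3]
        rw [Finset.sum_add_distrib, ← Finset.mul_sum, h0]
        simp [h]
      · have : ∀ j ∈ Finset.univ, ‖1 + c * ω j ^ (-1 : ℤ) + ε * c * ω j ^ (1 : ℤ)‖ ≤ (2 : ℝ) ^ a := by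
          intro j _
          simp only [hε, if_neg h]
          calc ‖1 + (c : ℂ) * ω j ^ (-1 : ℤ) + ((0 : ℝ) : ℂ) * c * ω j ^ (1 : ℤ)‖
              = ‖1 + (c : ℂ) * ω j ^ (-1 : ℤ)‖ := by simp
            _ ≤ 1 + |c| := by
                refine (norm_add_le _ _).trans ?_
                rw [norm_mul, norm_zpow, hωn, one_zpow, norm_one, Complex.norm_real]
                simp
            _ ≤ 2 ^ 1 := by linarith
            _ ≤ 2 ^ a := pow_le_pow_right₀ (by norm_num) (by omega)
        refine (Finset.sum_le_sum this).trans ?_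
        simp
    calc (N : ℝ)⁻¹ * (r ^ (2 * a))⁻¹ * _ ≤ (N : ℝ)⁻¹ * (r ^ (2 * a))⁻¹ * (N * 2 ^ a) :=
          mul_le_mul_of_nonneg_left key (by positivity)
      _ = 2 ^ a * (r ^ (2 * a))⁻¹ := by field_simp


lemma le_sphereNorm {n : ℕ} (f : MvPolynomial (Fin n) ℝ) (x : Fin n → ℝ)
    (hx : (∑ i, x i ^ 2) = 1) : |eval x f| ≤ sphereNorm f := by
  refine le_csSup ⟨∑ m ∈ f.support, |f.coeff m|, ?_⟩ ⟨x, hx, rfl⟩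
  rintro _ ⟨v, hv, rfl⟩
  rw [eval_eq']
  refine (Finset.abs_sum_le_sum_abs _ _).trans (Finset.sum_le_sum fun m _ => ?_)
  rw [abs_mul, Finset.abs_prod]
  refine mul_le_of_le_one_right (abs_nonneg _) (Finset.prod_le_one (fun _ _ => abs_nonneg _) ?_)
  intro i _
  rw [abs_pow]
  refine pow_le_one₀ (abs_nonneg _) ?_
  have := Finset.single_le_sum (f := fun i => v i ^ 2) (fun i _ => sq_nonneg _) (Finset.mem_univ i)
  rw [hv] at this
  exact abs_le_one_iff_mul_self_le_one.mpr (by nlinarith)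

lemma term_bound (a k : ℕ) (s : ℝ) (hak : a ≤ k) (hs : (a : ℝ) / k ≤ s) :
    (s ^ a)⁻¹ ≤ (k : ℝ) ^ a * ((a.factorial : ℝ))⁻¹ := by
  rcases Nat.eq_zero_or_pos a with rfl | ha
  · simp
  have ha' : (0 : ℝ) < a := by exact_mod_cast ha
  have hk : (0 : ℝ) < k := by exact_mod_cast (lt_of_lt_of_le ha hak)
  have h1 : (a.factorial : ℝ) ≤ (a : ℝ) ^ a := by exact_mod_cast Nat.factorial_le_pow a
  have h2 : ((a : ℝ) / k) ^ a ≤ s ^ a := pow_le_pow_left₀ (by positivity) hs a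
  have h3 : (a.factorial : ℝ) / (k : ℝ) ^ a ≤ s ^ a := by
    refine le_trans ?_ h2
    rw [div_pow]
    gcongr
  calc (s ^ a)⁻¹ ≤ ((a.factorial : ℝ) / (k : ℝ) ^ a)⁻¹ := by
        apply inv_anti₀ _ h3
        positivity
    _ = _ := by rw [inv_div, div_eq_mul_inv]

lemma pow_self_bound (k : ℕ) : (k : ℝ) ^ k ≤ 3 ^ k * k.factorial := by
  have h := Real.pow_div_factorial_le_exp (x := (k : ℝ)) (by positivity) k
  rw [div_le_iff₀ (by positivity)] at h
  refine h.trans (mul_le_mul_of_nonneg_right ?_ (by positivity))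
  rw [← Real.exp_one_pow]
  exact pow_le_pow_left₀ (Real.exp_pos _).le (Real.exp_one_lt_d9.le.trans (by norm_num)) k

lemma main_bound {n d : ℕ} {f : MvPolynomial (Fin n) ℝ}
    {g : (Fin n →₀ ℕ) → MvPolynomial (Fin n) ℝ} (hf : f.IsHomogeneous d) (hg : IsMLDecomp d f g)
    (α : Fin n →₀ ℕ) (hα : mdeg α ≤ d / 2) (y : Fin n → ℝ) (hy : (∑ i, y i ^ 2) = 1) :
    |eval y (g α)| ≤ sphereNorm f * (30 ^ d * orbitCard α) := by
  have hS0 : 0 ≤ sphereNorm f := (abs_nonneg _).trans (le_sphereNorm f y hy)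
  have hk : mdeg α = ∑ i, α i := by unfold mdeg; rw [Finsupp.sum_fintype]; simp
  have horb : orbitCard α = ((mdeg α).factorial : ℝ) * ∏ i, ((α i).factorial : ℝ)⁻¹ := by
    unfold orbitCard
    rw [Finsupp.prod_fintype _ _ (by simp), div_eq_mul_inv, Finset.prod_inv_distrib]
  set k := mdeg α with hkdef
  have hle : ∀ i, α i ≤ k := fun i => by
    rw [hk]; exact Finset.single_le_sum (f := α) (fun i _ => Nat.zero_le _) (Finset.mem_univ i)
  set s : Fin n → ℝ := fun i => (α i : ℝ) / k + 4 * y i ^ 2 with hs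
  have hs0 : ∀ i, 0 ≤ s i := fun i => by simp only [hs]; positivity
  have hr2 : ∀ i, Real.sqrt (s i) ^ 2 = s i := fun i => Real.sq_sqrt (hs0 i)
  have hsak : ∀ i, (α i : ℝ) / k ≤ s i := fun i => by simp only [hs]; nlinarith [sq_nonneg (y i)]
  have hco : ∀ i, _ := fun i => coord d (α i) (by have := hle i; omega) (y i) (Real.sqrt (s i))
    (Real.sqrt_nonneg _)
    (by
      apply Real.le_sqrt_of_sq_le
      rw [mul_pow, sq_abs]
      simp only [hs]
      have : (0 : ℝ) ≤ (α i : ℝ) / k := by positivity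
      linarith)
    (by
      intro h
      rw [Real.sqrt_eq_zero (hs0 i)] at h
      by_contra ha
      have ha' : 0 < α i := Nat.pos_of_ne_zero ha
      have hk' : 0 < k := lt_of_lt_of_le ha' (hle i)
      have : (0 : ℝ) < (α i : ℝ) / k := by positivity
      linarith [hsak i])
  choose w z hmom hz hw using hco
  have hex := extract w z y α hmom f g hg hα
  have hsum : ∑ i, s i ≤ (5 / 2) ^ 2 := by
    simp only [hs]
    rw [Finset.sum_add_distrib, ← Finset.mul_sum, hy, ← Finset.sum_div, ← Nat.cast_sum, ← hk]
    have : (k : ℝ) / k ≤ 1 := div_self_le_one _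
    linarith
  have hzb : ∀ j : Fin n → Fin (d + 2), ‖aeval (fun i => z i (j i)) f‖ ≤ sphereNorm f * 5 ^ d := by
    intro j
    have := complex_bound hf (sphereNorm f) (le_sphereNorm f) y hy (fun i => z i (j i)) (5 / 2)
      (by norm_num) ((Finset.sum_le_sum fun i _ => by
        rw [← hr2 i]; exact pow_le_pow_left₀ (norm_nonneg _) (hz i (j i)) 2).trans hsum)
    norm_num at this ⊢
    exact this
  have h1 : |eval y (g α)| ≤ (∏ i, ∑ j, ‖w i j‖) * (sphereNorm f * 5 ^ d) := by
    rw [← Real.norm_eq_abs, ← Complex.norm_real, ← hex, Fintype.prod_sum, Finset.sum_mul]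
    refine (norm_sum_le _ _).trans (Finset.sum_le_sum fun j _ => ?_)
    rw [norm_mul, norm_prod]
    exact mul_le_mul_of_nonneg_left (hzb j) (Finset.prod_nonneg fun _ _ => norm_nonneg _)
  have h2 : ∏ i, ∑ j, ‖w i j‖ ≤ 6 ^ d * orbitCard α := by
    calc ∏ i, ∑ j, ‖w i j‖
        ≤ ∏ i, (2 ^ α i * ((k : ℝ) ^ α i * ((α i).factorial : ℝ)⁻¹)) := by
          refine Finset.prod_le_prod (fun i _ => Finset.sum_nonneg fun _ _ => norm_nonneg _) ?_
          intro i _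
          refine (hw i).trans (mul_le_mul_of_nonneg_left ?_ (by positivity))
          rw [pow_mul, hr2]
          exact term_bound _ _ _ (hle i) (hsak i)
      _ = 2 ^ k * ((k : ℝ) ^ k * ∏ i, ((α i).factorial : ℝ)⁻¹) := by
          rw [Finset.prod_mul_distrib, Finset.prod_mul_distrib, Finset.prod_pow_eq_pow_sum,
            Finset.prod_pow_eq_pow_sum, ← hk]
      _ ≤ 2 ^ k * ((3 ^ k * k.factorial) * ∏ i, ((α i).factorial : ℝ)⁻¹) := by
          gcongr
          exact pow_self_bound k
      _ = 6 ^ k * orbitCard α := by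
          rw [horb, show (6 : ℝ) = 2 * 3 by norm_num, mul_pow]; ring
      _ ≤ 6 ^ d * orbitCard α := by
          refine mul_le_mul_of_nonneg_right (pow_le_pow_right₀ (by norm_num) (by omega)) ?_
          rw [horb]; positivity
  refine h1.trans ((mul_le_mul_of_nonneg_right h2 (by positivity)).trans (le_of_eq ?_))
  rw [show (30 : ℝ) = 6 * 5 by norm_num, mul_pow]; ring

theorem stmt8 : ∃ C : ℝ, C > 0 ∧
    ∀ (n d : ℕ) (f : MvPolynomial (Fin n) ℝ)
      (g : (Fin n →₀ ℕ) → MvPolynomial (Fin n) ℝ),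
      f.IsHomogeneous d → IsMLDecomp d f g →
      ∀ α : Fin n →₀ ℕ, mdeg α ≤ d / 2 →
        sphereNorm (g α) / (C ^ d * orbitCard α) ≤ sphereNorm f := by
  refine ⟨30, by norm_num, ?_⟩
  intro n d f g hf hg α hα
  have horb : 0 < orbitCard α := by
    unfold orbitCard
    rw [Finsupp.prod_fintype _ _ (by simp)]
    positivity
  rw [div_le_iff₀ (by positivity)]
  refine Real.sSup_le ?_ ?_
  · rintro _ ⟨y, hy, rfl⟩
    exact main_bound hf hg α hα y hy
  · refine mul_nonneg (Real.sSup_nonneg ?_) (by positivity)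
    rintro _ ⟨y, _, rfl⟩
    exact abs_nonneg _
end
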